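/- arXiv:2110.08065 — 6 statements merged into one kernel-verified Lean document; each statement's English description precedes it below -/
import Mathlib

section
/- Let N ≥ 1, let A₁, A₂, B be N×N real matrices, and let n₁, n₂ be real numbers with n₁² + n₂² = 1, n₁ ≠ 0 and n₂ ≠ 0. Assume that B, A₁ and L := n₁A₁ + n₂A₂ are invertible. Then the 2N×2N block matrix J whose (i,j)-block equals nᵢ B Aⱼ (for i,j ∈ {1,2}) is similar over ℝ to the 2N×2N block-diagonal matrix diag(0_N, B·L), i.e. there exists an invertible 2N×2N real matrix V with J = V · diag(0_N, B·L) · V⁻¹. -/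
open Matrix

/-- Conservative-form part (i) of Theorem 2.1: the block Jacobian
`J = [[n₁ B A₁, n₁ B A₂], [n₂ B A₁, n₂ B A₂]]` is similar to `diag(0, B·L)`
with `L = n₁ A₁ + n₂ A₂`. -/
theorem conservative_form_similar_block_diag
    (N : ℕ) (hN : 1 ≤ N)
    (A₁ A₂ B : Matrix (Fin N) (Fin N) ℝ) (n₁ n₂ : ℝ)
    (hn : n₁ ^ 2 + n₂ ^ 2 = 1) (hn₁ : n₁ ≠ 0) (hn₂ : n₂ ≠ 0)
    (hB : IsUnit B) (hA₁ : IsUnit A₁)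
    (hL : IsUnit (n₁ • A₁ + n₂ • A₂)) :
    ∃ V : Matrix (Fin N ⊕ Fin N) (Fin N ⊕ Fin N) ℝ, IsUnit V ∧
      Matrix.fromBlocks (n₁ • (B * A₁)) (n₁ • (B * A₂)) (n₂ • (B * A₁)) (n₂ • (B * A₂))
        = V * Matrix.fromBlocks 0 0 0 (B * (n₁ • A₁ + n₂ • A₂)) * V⁻¹ := by
  set L := n₁ • A₁ + n₂ • A₂ with hL_def
  have hA₁det := (Matrix.isUnit_iff_isUnit_det A₁).mp hA₁
  have hLL : n₁ • (L⁻¹ * A₁) + n₂ • (L⁻¹ * A₂) = 1 := by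
    rw [← Matrix.mul_smul, ← Matrix.mul_smul, ← Matrix.mul_add, ← hL_def,
      Matrix.nonsing_inv_mul _ ((Matrix.isUnit_iff_isUnit_det L).mp hL)]
  -- The first block column of `V` spans the kernel of `J`, the second its range.
  let V : Matrix (Fin N ⊕ Fin N) (Fin N ⊕ Fin N) ℝ :=
    fromBlocks (-(A₁⁻¹ * A₂)) (n₁ • 1) 1 (n₂ • 1)
  let W : Matrix (Fin N ⊕ Fin N) (Fin N ⊕ Fin N) ℝ :=
    fromBlocks (-(n₂ • (L⁻¹ * A₁))) (n₁ • (L⁻¹ * A₁)) (L⁻¹ * A₁) (L⁻¹ * A₂)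
  have hWV : W * V = 1 := by
    simp only [W, V, fromBlocks_multiply, ← fromBlocks_one, Matrix.mul_neg, Matrix.neg_mul,
      neg_neg, Matrix.smul_mul, Matrix.mul_smul, Matrix.mul_one, Matrix.mul_assoc,
      Matrix.mul_nonsing_inv_cancel_left _ _ hA₁det, hLL, neg_add_cancel]
    rw [add_comm, hLL, smul_neg, smul_comm, neg_add_cancel]
  have hV : IsUnit V := .of_mul_eq_one_right W hWV
  refine ⟨V, hV, ?_⟩
  have hJV : fromBlocks (n₁ • (B * A₁)) (n₁ • (B * A₂)) (n₂ • (B * A₁)) (n₂ • (B * A₂)) * V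
      = V * fromBlocks 0 0 0 (B * L) := by
    simp only [V, hL_def, fromBlocks_multiply, Matrix.mul_neg, Matrix.smul_mul, Matrix.mul_smul,
      Matrix.mul_one, Matrix.one_mul, Matrix.mul_zero, Matrix.mul_assoc, Matrix.mul_add,
      Matrix.mul_nonsing_inv_cancel_left _ _ hA₁det, neg_add_cancel, zero_add, add_zero,
      smul_comm n₁ n₂]
  rw [← hJV, Matrix.mul_nonsing_inv_cancel_right _ _ ((Matrix.isUnit_iff_isUnit_det V).mp hV)]
end

section
/- Let N ≥ 1, let A₁ and A₂ be symmetric N×N real matrices, let S be a symmetric positive definite N×N real matrix, and let n₁, n₂ be real numbers with n₁² + n₂² = 1, n₁ ≠ 0 and n₂ ≠ 0. Assume A₁ and L := n₁A₁ + n₂A₂ are invertible. Let S^{1/2} denote the unique symmetric positive definite square root of S. Then the 2N×2N block matrix J̃ whose (i,j)-block equals nᵢ S⁻¹ Aⱼ (for i,j ∈ {1,2}) is similar over ℝ to the block-diagonal matrix diag(0_N, λ̃), where λ̃ := S^{−1/2} L S^{−1/2}, and λ̃ is a symmetric matrix. -/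
open Matrix

/-- If `W * U * P = P * D` and `W` annihilates `(K, 1)ᵀ`, then the columns `(K, 1)ᵀ` and `U * P`
intertwine `U * W` with `diag(0, D)`; here `U = (u₁, u₂)ᵀ` is scalar and `W = (B₁, B₂)`. -/
lemma fromBlocks_smul_mul_intertwine {n : Type*} [Fintype n] [DecidableEq n]
    {B₁ B₂ K P D : Matrix n n ℝ} {u₁ u₂ : ℝ}
    (hK : B₁ * K + B₂ = 0) (hD : (u₁ • B₁ + u₂ • B₂) * P = P * D) :
    Matrix.fromBlocks (u₁ • B₁) (u₁ • B₂) (u₂ • B₁) (u₂ • B₂)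
        * Matrix.fromBlocks K (u₁ • P) 1 (u₂ • P)
      = Matrix.fromBlocks K (u₁ • P) 1 (u₂ • P) * Matrix.fromBlocks 0 0 0 D := by
  have hleft (c : ℝ) : (c • B₁) * K + c • B₂ = 0 := by
    rw [smul_mul_assoc, ← smul_add, hK, smul_zero]
  have hright (c : ℝ) : (c • B₁) * (u₁ • P) + (c • B₂) * (u₂ • P) = (c • P) * D := by
    rw [smul_mul_assoc c P D, ← hD, add_mul, smul_add]
    simp only [smul_mul_assoc, mul_smul_comm, smul_comm c]
  simp only [Matrix.fromBlocks_multiply, mul_one, mul_zero, add_zero, zero_add, hleft, hright]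

/-- The columns spanning the kernel of `(A₁, A₂)` together with `(u₁ P, u₂ P)ᵀ` form a basis. -/
lemma isUnit_fromBlocks_ker_smul {n : Type*} [Fintype n] [DecidableEq n]
    {A₁ A₂ K P : Matrix n n ℝ} {u₁ u₂ : ℝ} (hK : A₁ * K + A₂ = 0) (hP : IsUnit P)
    (hL : IsUnit (u₁ • A₁ + u₂ • A₂)) :
    IsUnit (Matrix.fromBlocks K (u₁ • P) 1 (u₂ • P)) := by
  obtain ⟨M, hM⟩ := hL.exists_left_inv
  obtain ⟨Q, hQ⟩ := hP.exists_left_inv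
  have hMK : M * (A₁ * K) = -(M * A₂) := by
    rw [eq_neg_of_add_eq_zero_left hK, mul_neg]
  have hMP : u₁ • (M * (A₁ * P)) + u₂ • (M * (A₂ * P)) = P := by
    calc _ = M * (u₁ • A₁ + u₂ • A₂) * P := by
          simp only [mul_add, add_mul, mul_smul_comm, smul_mul_assoc, mul_assoc]
      _ = P := by rw [hM, one_mul]
  refine IsUnit.of_mul_eq_one_right
    (Matrix.fromBlocks (-(u₂ • (M * A₁))) (1 - u₂ • (M * A₂)) (Q * (M * A₁)) (Q * (M * A₂))) ?_
  rw [Matrix.fromBlocks_multiply, ← Matrix.fromBlocks_one]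
  congr 1
  · simp only [neg_mul, smul_mul_assoc, mul_assoc, hMK, mul_one, smul_neg]
    abel
  · calc _ = u₂ • P - u₂ • (u₁ • (M * (A₁ * P)) + u₂ • (M * (A₂ * P))) := by
          simp only [neg_mul, sub_mul, one_mul, smul_mul_assoc, mul_smul_comm, mul_assoc]
          module
      _ = 0 := by rw [hMP, sub_self]
  · simp only [mul_assoc, hMK, mul_one, mul_neg, neg_add_cancel]
  · calc _ = Q * (u₁ • (M * (A₁ * P)) + u₂ • (M * (A₂ * P))) := by
          simp only [mul_add, mul_smul_comm, mul_assoc]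
      _ = 1 := by rw [hMP, hQ]

/-- Capacity-form part (ii) of Theorem 2.1: with `S` symmetric positive definite with
symmetric positive definite square root `R` (i.e. `R * R = S`), the block Jacobian
`J̃ = [[n₁ S⁻¹ A₁, n₁ S⁻¹ A₂], [n₂ S⁻¹ A₁, n₂ S⁻¹ A₂]]` is similar to
`diag(0, λ̃)` with `λ̃ = S^{-1/2} (n₁ A₁ + n₂ A₂) S^{-1/2}`, and `λ̃` is symmetric. -/
theorem capacity_form_similar_block_diag
    (N : ℕ) (hN : 1 ≤ N)
    (A₁ A₂ S R : Matrix (Fin N) (Fin N) ℝ) (n₁ n₂ : ℝ)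
    (hA₁s : A₁.IsSymm) (hA₂s : A₂.IsSymm)
    (hS : S.PosDef) (hR : R.PosDef) (hRS : R * R = S)
    (hn : n₁ ^ 2 + n₂ ^ 2 = 1) (hn₁ : n₁ ≠ 0) (hn₂ : n₂ ≠ 0)
    (hA₁ : IsUnit A₁) (hL : IsUnit (n₁ • A₁ + n₂ • A₂)) :
    (R⁻¹ * (n₁ • A₁ + n₂ • A₂) * R⁻¹).IsSymm ∧
    ∃ V : Matrix (Fin N ⊕ Fin N) (Fin N ⊕ Fin N) ℝ, IsUnit V ∧
      Matrix.fromBlocks (n₁ • (S⁻¹ * A₁)) (n₁ • (S⁻¹ * A₂))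
          (n₂ • (S⁻¹ * A₁)) (n₂ • (S⁻¹ * A₂))
        = V * Matrix.fromBlocks 0 0 0 (R⁻¹ * (n₁ • A₁ + n₂ • A₂) * R⁻¹) * V⁻¹ := by
  have hRs : R⁻¹.IsSymm := by
    have h := hR.isHermitian.inv
    rwa [Matrix.IsHermitian, Matrix.conjTranspose_eq_transpose_of_trivial] at h
  have hLs : (n₁ • A₁ + n₂ • A₂).IsSymm := (hA₁s.smul n₁).add (hA₂s.smul n₂)
  refine ⟨?_, ?_⟩
  · rw [Matrix.IsSymm, Matrix.transpose_mul, Matrix.transpose_mul, hRs.eq, hLs.eq, mul_assoc]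
  have hK : A₁ * (-(A₁⁻¹ * A₂)) + A₂ = 0 := by
    rw [mul_neg, Matrix.mul_nonsing_inv_cancel_left _ _ ((Matrix.isUnit_iff_isUnit_det _).1 hA₁),
      neg_add_cancel]
  have hV := isUnit_fromBlocks_ker_smul hK hR.inv.isUnit hL
  refine ⟨_, hV, ?_⟩
  rw [← fromBlocks_smul_mul_intertwine (B₁ := S⁻¹ * A₁) (B₂ := S⁻¹ * A₂),
    Matrix.mul_nonsing_inv_cancel_right _ _ ((Matrix.isUnit_iff_isUnit_det _).1 hV)]
  · rw [mul_assoc, ← mul_add, hK, mul_zero]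
  · rw [← mul_smul_comm, ← mul_smul_comm, ← mul_add, ← hRS, Matrix.mul_inv_rev]
    simp only [mul_assoc]
end

section
/- Let N ≥ 1, let A₁ and A₂ be symmetric N×N real matrices, let S be a symmetric positive definite N×N real matrix, and let n₁, n₂ be real numbers with n₁² + n₂² = 1, n₁ ≠ 0 and n₂ ≠ 0. Assume A₁ and n₁A₁ + n₂A₂ are invertible. Then the 2N×2N block matrix J̃ whose (i,j)-block equals nᵢ S⁻¹ Aⱼ is diagonalizable over ℝ: there exist an invertible real 2N×2N matrix W and a real diagonal 2N×2N matrix Λ with J̃ = W Λ W⁻¹. In particular all eigenvalues of J̃ are real. -/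
open Matrix

open scoped MatrixOrder Matrix.Norms.L2Operator in
theorem Matrix.PosDef.exists_diagonalization_inv_mul {n : Type*} [Fintype n] [DecidableEq n]
    {S L : Matrix n n ℝ} (hS : S.PosDef) (hL : L.IsSymm) :
    ∃ (V : Matrix n n ℝ) (d : n → ℝ), IsUnit V ∧ S⁻¹ * L * V = V * diagonal d := by
  obtain ⟨B, hB, rfl⟩ := CStarAlgebra.isStrictlyPositive_iff_eq_star_mul_self.mp
    hS.isStrictlyPositive
  have hM : (B⁻¹ᴴ * L * B⁻¹).IsHermitian :=
    isHermitian_conjTranspose_mul_mul _ (by simpa [IsHermitian] using hL.eq)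
  let U : Matrix n n ℝ := ↑hM.eigenvectorUnitary
  have hUM : B⁻¹ᴴ * L * B⁻¹ * U = U * diagonal hM.eigenvalues := by
    conv_lhs => rw [hM.spectral_theorem, Unitary.conjStarAlgAut_apply]
    rw [mul_assoc, Unitary.coe_star_mul_self, mul_one]
    rfl
  refine ⟨B⁻¹ * U, hM.eigenvalues, ?_, ?_⟩
  · exact (isUnit_nonsing_inv_iff.2 hB).mul (Unitary.toUnits hM.eigenvectorUnitary).isUnit
  · rw [mul_assoc B⁻¹ U, ← hUM, star_eq_conjTranspose, mul_inv_rev, ← conjTranspose_nonsing_inv]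
    simp only [mul_assoc]

theorem Matrix.fromBlocks_mul_eigenbasis {n R : Type*} [Fintype n] [DecidableEq n] [CommRing R]
    {T A₁ A₂ V : Matrix n n R} {a b : R} {d : n → R} (hA₁ : IsUnit A₁)
    (hV : T * (a • A₁ + b • A₂) * V = V * diagonal d) :
    fromBlocks (a • (T * A₁)) (a • (T * A₂)) (b • (T * A₁)) (b • (T * A₂)) *
        fromBlocks (-(A₁⁻¹ * A₂)) (a • V) 1 (b • V) =
      fromBlocks (-(A₁⁻¹ * A₂)) (a • V) 1 (b • V) * diagonal (Sum.elim 0 d) := by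
  have h : A₁ * (A₁⁻¹ * A₂) = A₂ :=
    mul_nonsing_inv_cancel_left _ _ ((isUnit_iff_isUnit_det _).1 hA₁)
  have hV' : a • (T * (A₁ * V)) + b • (T * (A₂ * V)) = V * diagonal d := by
    rw [← hV]; simp [mul_add, add_mul, mul_assoc]
  rw [← fromBlocks_diagonal, fromBlocks_multiply, fromBlocks_multiply]
  simp only [Pi.zero_def, diagonal_zero, smul_mul, Matrix.mul_smul, mul_neg, mul_assoc, h, mul_one,
    mul_zero, zero_add, add_zero, ← hV', neg_add_cancel]
  congr 1 <;> module

theorem Matrix.isUnit_fromBlocks_eigenbasis {n R : Type*} [Fintype n] [DecidableEq n] [CommRing R]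
    {A₁ A₂ V : Matrix n n R} {a b : R} (hA₁ : IsUnit A₁) (hL : IsUnit (a • A₁ + b • A₂))
    (hV : IsUnit V) :
    IsUnit (fromBlocks (-(A₁⁻¹ * A₂)) (a • V) 1 (b • V)) := by
  set L := a • A₁ + b • A₂ with hLdef
  have h : A₁ * (A₁⁻¹ * A₂) = A₂ :=
    mul_nonsing_inv_cancel_left _ _ ((isUnit_iff_isUnit_det _).1 hA₁)
  have hLL : L⁻¹ * L = 1 := nonsing_inv_mul _ ((isUnit_iff_isUnit_det _).1 hL)
  have hVV : V⁻¹ * V = 1 := nonsing_inv_mul _ ((isUnit_iff_isUnit_det _).1 hV)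
  have hsum : a • (L⁻¹ * (A₁ * V)) + b • (L⁻¹ * (A₂ * V)) = V := by
    calc _ = L⁻¹ * L * V := by simp [hLdef, mul_add, add_mul, mul_assoc]
      _ = V := by rw [hLL, one_mul]
  have hsum' : a • (V⁻¹ * (L⁻¹ * (A₁ * V))) + b • (V⁻¹ * (L⁻¹ * (A₂ * V))) = 1 := by
    rw [← Matrix.mul_smul, ← Matrix.mul_smul V⁻¹ b, ← mul_add, hsum, hVV]
  refine IsUnit.of_mul_eq_one_right (fromBlocks (-(b • (L⁻¹ * A₁))) (1 - b • (L⁻¹ * A₂))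
    (V⁻¹ * (L⁻¹ * A₁)) (V⁻¹ * (L⁻¹ * A₂))) ?_
  rw [fromBlocks_multiply, ← fromBlocks_one]
  congr 1
  · simp [mul_assoc, h]
  · have : b • V = b • (a • (L⁻¹ * (A₁ * V)) + b • (L⁻¹ * (A₂ * V))) := by rw [hsum]
    simp only [sub_mul, neg_mul, one_mul, smul_mul, Matrix.mul_smul, mul_assoc]
    rw [this]
    module
  · simp [mul_assoc, h]
  · simpa [mul_assoc] using hsum'

theorem Matrix.isRoot_charpoly_map_of_eq_conj_diagonal {n R K : Type*} [Fintype n] [DecidableEq n]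
    [CommRing R] [Field K] [Algebra R K] {J W : Matrix n n R} {d : n → R} (hW : IsUnit W)
    (hJ : J = W * diagonal d * W⁻¹) {z : K}
    (hz : (J.map (algebraMap R K)).charpoly.IsRoot z) : ∃ i, z = algebraMap R K (d i) := by
  obtain ⟨U, rfl⟩ := hW
  rw [charpoly_map, hJ, charpoly_units_conj, charpoly_diagonal] at hz
  simpa [Polynomial.map_prod, Polynomial.eval_prod, Finset.prod_eq_zero_iff, sub_eq_zero] using hz

/-- Strong hyperbolicity of the capacity form (Theorem 2.1(ii)): the block Jacobian
`J̃ = [[n₁ S⁻¹ A₁, n₁ S⁻¹ A₂], [n₂ S⁻¹ A₁, n₂ S⁻¹ A₂]]` is diagonalizable over ℝ,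
and all its (complex) eigenvalues are real. -/
theorem capacity_form_diagonalizable
    (N : ℕ) (hN : 1 ≤ N)
    (A₁ A₂ S : Matrix (Fin N) (Fin N) ℝ) (n₁ n₂ : ℝ)
    (hA₁s : A₁.IsSymm) (hA₂s : A₂.IsSymm)
    (hS : S.PosDef)
    (hn : n₁ ^ 2 + n₂ ^ 2 = 1) (hn₁ : n₁ ≠ 0) (hn₂ : n₂ ≠ 0)
    (hA₁ : IsUnit A₁) (hL : IsUnit (n₁ • A₁ + n₂ • A₂)) :
    (∃ (W : Matrix (Fin N ⊕ Fin N) (Fin N ⊕ Fin N) ℝ) (d : Fin N ⊕ Fin N → ℝ),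
      IsUnit W ∧
      Matrix.fromBlocks (n₁ • (S⁻¹ * A₁)) (n₁ • (S⁻¹ * A₂))
          (n₂ • (S⁻¹ * A₁)) (n₂ • (S⁻¹ * A₂))
        = W * Matrix.diagonal d * W⁻¹) ∧
    ∀ z : ℂ,
      ((Matrix.fromBlocks (n₁ • (S⁻¹ * A₁)) (n₁ • (S⁻¹ * A₂))
          (n₂ • (S⁻¹ * A₁)) (n₂ • (S⁻¹ * A₂))).map (algebraMap ℝ ℂ)).charpoly.IsRoot z →
        z.im = 0 := by
  obtain ⟨V, d, hV, hVd⟩ := hS.exists_diagonalization_inv_mul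
    ((hA₁s.smul n₁).add (hA₂s.smul n₂))
  have hW := isUnit_fromBlocks_eigenbasis hA₁ hL hV
  have hJ := fromBlocks_mul_eigenbasis hA₁ hVd
  rw [← hW.unit_spec, ← Units.eq_mul_inv_iff_mul_eq, coe_units_inv, hW.unit_spec] at hJ
  refine ⟨⟨_, _, hW, hJ⟩, fun z hz => ?_⟩
  obtain ⟨i, rfl⟩ := isRoot_charpoly_map_of_eq_conj_diagonal hW hJ hz
  exact Complex.ofReal_im _
end

section
/- Let N ≥ 1, let A₁ and A₂ be symmetric N×N real matrices, let S be a symmetric positive definite N×N real matrix, let v > 0 be a real number, and let n₁, n₂ be real numbers with n₁² + n₂² = 1, n₁ ≠ 0 and n₂ ≠ 0. Assume A₁ and L := n₁A₁ + n₂A₂ are invertible. Then the 2N×2N block matrix J whose (i,j)-block equals nᵢ (v S⁻¹) Aⱼ is diagonalizable over ℝ with all eigenvalues real. -/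
open Matrix

open scoped MatrixOrder in
/-- The product of a positive definite and a symmetric real matrix is diagonalizable. -/
lemma Matrix.PosDef.exists_mul_eq_mul_diagonal {n : Type*} [Fintype n] [DecidableEq n]
    {T L : Matrix n n ℝ} (hT : T.PosDef) (hL : L.IsSymm) :
    ∃ (P : Matrix n n ℝ) (d : n → ℝ), IsUnit P ∧ T * L * P = P * diagonal d := by
  obtain ⟨R, hR, rfl⟩ :=
    CStarAlgebra.isStrictlyPositive_iff_eq_star_mul_self.mp hT.isStrictlyPositive
  have hM : (R * L * star R).IsHermitian :=
    isHermitian_mul_mul_conjTranspose R (by simpa [IsHermitian] using hL.eq)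
  have hU := hM.spectral_theorem
  rw [Unitary.conjStarAlgAut_apply] at hU
  set U := hM.eigenvectorUnitary
  refine ⟨star R * (U : Matrix n n ℝ), hM.eigenvalues,
    hR.star.mul (Unitary.toUnits U).isUnit, ?_⟩
  calc star R * R * L * (star R * (U : Matrix n n ℝ))
      = star R * (R * L * star R) * (U : Matrix n n ℝ) := by simp only [mul_assoc]
    _ = star R * (U : Matrix n n ℝ) * diagonal hM.eigenvalues := by
      conv_lhs => rw [hU]
      simp only [mul_assoc, Unitary.coe_star_mul_self, mul_one]
      rfl

/-- Every complex eigenvalue of a matrix that is diagonalizable over `ℝ` is real. -/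
lemma Matrix.im_eq_zero_of_isRoot_charpoly_map {n : Type*} [Fintype n] [DecidableEq n]
    {W : Matrix n n ℝ} (hW : IsUnit W) (d : n → ℝ) {z : ℂ}
    (hz : ((W * diagonal d * W⁻¹).map (algebraMap ℝ ℂ)).charpoly.IsRoot z) : z.im = 0 := by
  obtain ⟨W, rfl⟩ := hW
  rw [charpoly_map, charpoly_units_conj, charpoly_diagonal, Polynomial.IsRoot,
    Polynomial.map_prod, Polynomial.eval_prod, Finset.prod_eq_zero_iff] at hz
  obtain ⟨i, -, hi⟩ := hz
  have hzi : z = d i := by simpa [sub_eq_zero] using hi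
  simp [hzi]

/-- If `X * (a • A + b • B)` is diagonalizable, then so is the block matrix with rows
`a • X * [A, B]` and `b • X * [A, B]`. -/
lemma Matrix.exists_fromBlocks_eq_mul_diagonal_mul_inv {n : Type*} [Fintype n] [DecidableEq n]
    {A B X P : Matrix n n ℝ} {a b : ℝ} {d : n → ℝ} (hA : IsUnit A)
    (hL : IsUnit (a • A + b • B)) (hP : IsUnit P)
    (h : X * (a • A + b • B) * P = P * diagonal d) :
    ∃ (W : Matrix (n ⊕ n) (n ⊕ n) ℝ) (e : n ⊕ n → ℝ), IsUnit W ∧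
      fromBlocks (a • (X * A)) (a • (X * B)) (b • (X * A)) (b • (X * B))
        = W * diagonal e * W⁻¹ := by
  have hAdet : IsUnit A.det := (isUnit_iff_isUnit_det A).mp hA
  have hW : IsUnit (fromBlocks (a • P) (-(A⁻¹ * B)) (b • P) 1) := by
    rw [isUnit_iff_isUnit_det, det_fromBlocks_one₂₂, ← isUnit_iff_isUnit_det]
    have : a • P - -(A⁻¹ * B) * (b • P) = A⁻¹ * (a • A + b • B) * P := by
      simp [mul_add, add_mul, nonsing_inv_mul _ hAdet]
    rw [this]
    exact ((isUnit_nonsing_inv_iff.mpr hA).mul hL).mul hP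
  refine ⟨_, Sum.elim d 0, hW, ?_⟩
  rw [isUnit_iff_isUnit_det] at hW
  have hAB : X * A * (A⁻¹ * B) = X * B := by
    rw [mul_assoc, mul_nonsing_inv_cancel_left _ _ hAdet]
  have hXP : a • (X * A * P) + b • (X * B * P) = P * diagonal d := by
    rw [← h]; simp [mul_add, add_mul]
  have hcol (c : ℝ) : c • (X * A) * (a • P) + c • (X * B) * (b • P) = c • P * diagonal d := by
    rw [smul_mul, smul_mul, smul_mul, ← smul_add, ← hXP, Matrix.mul_smul, Matrix.mul_smul]
  have hJW : fromBlocks (a • (X * A)) (a • (X * B)) (b • (X * A)) (b • (X * B)) *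
        fromBlocks (a • P) (-(A⁻¹ * B)) (b • P) 1 =
      fromBlocks (a • P) (-(A⁻¹ * B)) (b • P) 1 * diagonal (Sum.elim d 0) := by
    rw [← fromBlocks_diagonal, fromBlocks_multiply, fromBlocks_multiply, hcol, hcol]
    simp [hAB]
  rw [← hJW, mul_nonsing_inv_cancel_right _ _ hW]

/-- Hyperbolicity of the conservative form with deterministic velocity `v > 0`
(Section 2.2): the block Jacobian `J = [[n₁ (v S⁻¹) A₁, n₁ (v S⁻¹) A₂],
[n₂ (v S⁻¹) A₁, n₂ (v S⁻¹) A₂]]` is diagonalizable over ℝ with all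
(complex) eigenvalues real. -/
theorem conservative_form_deterministic_velocity_diagonalizable
    (N : ℕ) (hN : 1 ≤ N)
    (A₁ A₂ S : Matrix (Fin N) (Fin N) ℝ) (v n₁ n₂ : ℝ)
    (hA₁s : A₁.IsSymm) (hA₂s : A₂.IsSymm)
    (hS : S.PosDef) (hv : 0 < v)
    (hn : n₁ ^ 2 + n₂ ^ 2 = 1) (hn₁ : n₁ ≠ 0) (hn₂ : n₂ ≠ 0)
    (hA₁ : IsUnit A₁) (hL : IsUnit (n₁ • A₁ + n₂ • A₂)) :
    (∃ (W : Matrix (Fin N ⊕ Fin N) (Fin N ⊕ Fin N) ℝ) (d : Fin N ⊕ Fin N → ℝ),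
      IsUnit W ∧
      Matrix.fromBlocks (n₁ • ((v • S⁻¹) * A₁)) (n₁ • ((v • S⁻¹) * A₂))
          (n₂ • ((v • S⁻¹) * A₁)) (n₂ • ((v • S⁻¹) * A₂))
        = W * Matrix.diagonal d * W⁻¹) ∧
    ∀ z : ℂ,
      ((Matrix.fromBlocks (n₁ • ((v • S⁻¹) * A₁)) (n₁ • ((v • S⁻¹) * A₂))
          (n₂ • ((v • S⁻¹) * A₁)) (n₂ • ((v • S⁻¹) * A₂))).map
            (algebraMap ℝ ℂ)).charpoly.IsRoot z →
        z.im = 0 := by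
  obtain ⟨P, d, hP, hPd⟩ := (hS.inv.smul hv).exists_mul_eq_mul_diagonal
    ((hA₁s.smul n₁).add (hA₂s.smul n₂))
  obtain ⟨W, e, hW, hJ⟩ := exists_fromBlocks_eq_mul_diagonal_mul_inv hA₁ hL hP hPd
  refine ⟨⟨W, e, hW, hJ⟩, fun z hz => ?_⟩
  rw [hJ] at hz
  exact im_eq_zero_of_isRoot_charpoly_map hW e hz
end

section
/- For a = (a₀,a₁) ∈ ℝ², let 𝒫(a) denote the symmetric 2×2 real matrix with both diagonal entries equal to a₀ and both off-diagonal entries equal to a₁, let ℛ(a) := (a₀²+a₁², 2a₀a₁), and for ρ = (ρ₀,ρ₁) with ρ₀ ≥ |ρ₁| let ℛ⁻¹(ρ) := ½(√(ρ₀+ρ₁)+√(ρ₀−ρ₁), √(ρ₀+ρ₁)−√(ρ₀−ρ₁)). Let Ω := {(u,w) ∈ ℝ²×ℝ² : ρ(u,w)₀ > |ρ(u,w)₁|} where ρ(u,w) := ℛ(u)+ℛ(w), and define N(u,w) := ℛ⁻¹(ρ(u,w)) on Ω. Then Ω is open, N is Fréchet differentiable on Ω, the matrix 𝒫(N(u,w))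 is positive definite for all (u,w) ∈ Ω, and the partial Fréchet derivatives of N (as linear maps ℝ² → ℝ²) satisfy 𝒫(N(u,w)) ∘ D_u N(u,w) = 𝒫(u) and 𝒫(N(u,w)) ∘ D_w N(u,w) = 𝒫(w), where a 2×2 matrix is identified with the linear map it induces. -/
noncomputable section

/-- Action of the Galerkin matrix `𝒫(a)` on a vector (two basis functions). -/
def galerkinMul (a x : ℝ × ℝ) : ℝ × ℝ :=
  (a.1 * x.1 + a.2 * x.2, a.2 * x.1 + a.1 * x.2)

/-- The Galerkin matrix `𝒫(a)` (two basis functions). -/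
def galerkinMat (a : ℝ × ℝ) : Matrix (Fin 2) (Fin 2) ℝ := !![a.1, a.2; a.2, a.1]

/-- The second-moment map `ℛ(u) = (u₀² + u₁², 2 u₀ u₁)`. -/
def secondMoment (u : ℝ × ℝ) : ℝ × ℝ := (u.1 ^ 2 + u.2 ^ 2, 2 * u.1 * u.2)

/-- The Galerkin square root `ℛ⁻¹(ρ)`. -/
def galerkinSqrt (ρ : ℝ × ℝ) : ℝ × ℝ :=
  ((Real.sqrt (ρ.1 + ρ.2) + Real.sqrt (ρ.1 - ρ.2)) / 2,
   (Real.sqrt (ρ.1 + ρ.2) - Real.sqrt (ρ.1 - ρ.2)) / 2)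

/-- `ρ(u,w) = ℛ(u) + ℛ(w)`. -/
def rhoFun (p : (ℝ × ℝ) × (ℝ × ℝ)) : ℝ × ℝ := secondMoment p.1 + secondMoment p.2

/-- The intrusive Euclidean norm `N(u,w) = ℛ⁻¹(ℛ(u) + ℛ(w))`. -/
def normFun (p : (ℝ × ℝ) × (ℝ × ℝ)) : ℝ × ℝ := galerkinSqrt (rhoFun p)

/-- The admissible set `Ω = {(u,w) : ρ(u,w)₀ > |ρ(u,w)₁|}`. -/
def admissibleSet : Set ((ℝ × ℝ) × (ℝ × ℝ)) := {p | |(rhoFun p).2| < (rhoFun p).1}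

theorem differentiable_secondMoment : Differentiable ℝ secondMoment := by
  unfold secondMoment
  fun_prop

theorem fderiv_secondMoment_apply (a h : ℝ × ℝ) :
    fderiv ℝ secondMoment a h = (2 : ℝ) • galerkinMul a h := by
  have h₁ : HasFDerivAt (fun u : ℝ × ℝ => u.1) (ContinuousLinearMap.fst ℝ ℝ ℝ) a := hasFDerivAt_fst
  have h₂ : HasFDerivAt (fun u : ℝ × ℝ => u.2) (ContinuousLinearMap.snd ℝ ℝ ℝ) a := hasFDerivAt_snd
  have key : HasFDerivAt secondMoment _ a :=
    ((h₁.pow 2).add (h₂.pow 2)).prodMk ((h₁.const_mul 2).mul h₂)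
  rw [key.fderiv]
  ext <;> simp [galerkinMul] <;> ring

theorem differentiable_rhoFun : Differentiable ℝ rhoFun :=
  (differentiable_secondMoment.comp differentiable_fst).add
    (differentiable_secondMoment.comp differentiable_snd)

theorem isOpen_admissibleSet : IsOpen admissibleSet :=
  isOpen_lt (continuous_snd.comp differentiable_rhoFun.continuous).abs
    (continuous_fst.comp differentiable_rhoFun.continuous)

theorem differentiableAt_galerkinSqrt {ρ : ℝ × ℝ} (hρ : |ρ.2| < ρ.1) :
    DifferentiableAt ℝ galerkinSqrt ρ := by
  obtain ⟨h₁, h₂⟩ := abs_lt.1 hρ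
  have ha : DifferentiableAt ℝ (fun ρ : ℝ × ℝ => Real.sqrt (ρ.1 + ρ.2)) ρ :=
    (differentiableAt_fst.add differentiableAt_snd).sqrt (by simp; linarith)
  have hs : DifferentiableAt ℝ (fun ρ : ℝ × ℝ => Real.sqrt (ρ.1 - ρ.2)) ρ :=
    (differentiableAt_fst.sub differentiableAt_snd).sqrt (by simp; linarith)
  unfold galerkinSqrt
  fun_prop

theorem secondMoment_galerkinSqrt {ρ : ℝ × ℝ} (hρ : |ρ.2| ≤ ρ.1) :
    secondMoment (galerkinSqrt ρ) = ρ := by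
  obtain ⟨h₁, h₂⟩ := abs_le.1 hρ
  have ha := Real.sq_sqrt (show 0 ≤ ρ.1 + ρ.2 by linarith)
  have hs := Real.sq_sqrt (show 0 ≤ ρ.1 - ρ.2 by linarith)
  ext <;> simp only [secondMoment, galerkinSqrt]
  · linear_combination (ha + hs) / 2
  · linear_combination (ha - hs) / 2

theorem differentiableAt_normFun {p : (ℝ × ℝ) × (ℝ × ℝ)} (hp : p ∈ admissibleSet) :
    DifferentiableAt ℝ normFun p :=
  (differentiableAt_galerkinSqrt hp).comp p (differentiable_rhoFun p)

theorem posDef_galerkinMat {a : ℝ × ℝ} (ha : |a.2| < a.1) : (galerkinMat a).PosDef := by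
  obtain ⟨h₁, h₂⟩ := abs_lt.1 ha
  refine Matrix.PosDef.of_dotProduct_mulVec_pos ?_ fun x hx => ?_
  · ext i j
    fin_cases i <;> fin_cases j <;> simp [galerkinMat]
  · have hne : x 0 + x 1 ≠ 0 ∨ x 0 - x 1 ≠ 0 := by
      by_contra! hc
      refine hx (funext fun i => ?_)
      fin_cases i <;> simp <;> linarith [hc.1, hc.2]
    have hform : star x ⬝ᵥ (galerkinMat a).mulVec x =
        ((a.1 + a.2) * (x 0 + x 1) ^ 2 + (a.1 - a.2) * (x 0 - x 1) ^ 2) / 2 := by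
      simp [galerkinMat, dotProduct, Matrix.mulVec, Fin.sum_univ_two]
      ring
    rw [hform]
    have hadd : 0 < a.1 + a.2 := by linarith
    have hsub : 0 < a.1 - a.2 := by linarith
    rcases hne with h | h <;> positivity

theorem abs_snd_galerkinSqrt_lt {ρ : ℝ × ℝ} (hρ : |ρ.2| < ρ.1) :
    |(galerkinSqrt ρ).2| < (galerkinSqrt ρ).1 := by
  obtain ⟨h₁, h₂⟩ := abs_lt.1 hρ
  have ha := Real.sqrt_pos.2 (show 0 < ρ.1 + ρ.2 by linarith)
  have hs := Real.sqrt_pos.2 (show 0 < ρ.1 - ρ.2 by linarith)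
  rw [abs_lt]
  constructor <;> simp only [galerkinSqrt] <;> linarith

/-- If the second moment of `f` agrees near `x` with that of the identity up to a constant, then
implicit differentiation determines the derivative of `f` at `x`. -/
theorem galerkinMul_fderiv_of_secondMoment_eq {f : ℝ × ℝ → ℝ × ℝ} {x c : ℝ × ℝ}
    (hf : DifferentiableAt ℝ f x)
    (heq : ∀ᶠ y in nhds x, secondMoment (f y) = secondMoment y + c) (h : ℝ × ℝ) :
    galerkinMul (f x) (fderiv ℝ f x h) = galerkinMul x h := by
  have hd : fderiv ℝ (secondMoment ∘ f) x = fderiv ℝ (fun y => secondMoment y + c) x :=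
    Filter.EventuallyEq.fderiv_eq heq
  rw [fderiv_comp x (differentiable_secondMoment _) hf, fderiv_add_const] at hd
  have hd' := DFunLike.congr_fun hd h
  rw [ContinuousLinearMap.comp_apply, fderiv_secondMoment_apply, fderiv_secondMoment_apply] at hd'
  exact smul_right_injective (ℝ × ℝ) (two_ne_zero' ℝ) hd'

theorem secondMoment_normFun {p : (ℝ × ℝ) × (ℝ × ℝ)} (hp : p ∈ admissibleSet) :
    secondMoment (normFun p) = secondMoment p.1 + secondMoment p.2 :=
  secondMoment_galerkinSqrt (le_of_lt hp)

/-- Key Jacobian computation in the proof of Theorem 2.1 (case `d = 2`, `K = 1`):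
`Ω` is open, `N` is Fréchet differentiable on `Ω`, `𝒫(N(u,w))` is positive definite,
and `𝒫(N(u,w)) ∘ D_u N(u,w) = 𝒫(u)`, `𝒫(N(u,w)) ∘ D_w N(u,w) = 𝒫(w)`. -/
theorem norm_gPC_modes_jacobian :
    IsOpen admissibleSet ∧
    DifferentiableOn ℝ normFun admissibleSet ∧
    (∀ p ∈ admissibleSet, (galerkinMat (normFun p)).PosDef) ∧
    (∀ p ∈ admissibleSet, ∀ h : ℝ × ℝ,
      galerkinMul (normFun p) (fderiv ℝ (fun u => normFun (u, p.2)) p.1 h)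
        = galerkinMul p.1 h) ∧
    (∀ p ∈ admissibleSet, ∀ h : ℝ × ℝ,
      galerkinMul (normFun p) (fderiv ℝ (fun w => normFun (p.1, w)) p.2 h)
        = galerkinMul p.2 h) := by
  refine ⟨isOpen_admissibleSet,
    fun p hp => (differentiableAt_normFun hp).differentiableWithinAt,
    fun p hp => posDef_galerkinMat (abs_snd_galerkinSqrt_lt hp), ?_, ?_⟩
  · rintro ⟨u, w⟩ hp h
    have hd : DifferentiableAt ℝ (fun u' => normFun (u', w)) u :=
      DifferentiableAt.comp (g := normFun) u (differentiableAt_normFun hp)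
        (by fun_prop : DifferentiableAt ℝ (fun u' => (u', w)) u)
    have hcont : Continuous fun u' : ℝ × ℝ => (u', w) := by fun_prop
    refine galerkinMul_fderiv_of_secondMoment_eq (c := secondMoment w) hd ?_ h
    filter_upwards [hcont.continuousAt.preimage_mem_nhds (isOpen_admissibleSet.mem_nhds hp)]
      with y hy using secondMoment_normFun hy
  · rintro ⟨u, w⟩ hp h
    have hd : DifferentiableAt ℝ (fun w' => normFun (u, w')) w :=
      DifferentiableAt.comp (g := normFun) w (differentiableAt_normFun hp)
        (by fun_prop : DifferentiableAt ℝ (fun w' => (u, w')) w)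
    have hcont : Continuous fun w' : ℝ × ℝ => (u, w') := by fun_prop
    refine galerkinMul_fderiv_of_secondMoment_eq (c := secondMoment u) hd ?_ h
    filter_upwards [hcont.continuousAt.preimage_mem_nhds (isOpen_admissibleSet.mem_nhds hp)]
      with y hy using (secondMoment_normFun hy).trans (add_comm _ _)

end
end

section
/- Let ρ = (ρ₀,ρ₁) ∈ ℝ² satisfy ρ₀ > |ρ₁|, and define f : ℝ² → ℝ by f(α) := (1/3)α₀³ + α₀α₁² − α₀ρ₀ − α₁ρ₁ on the open convex cone C° := {α ∈ ℝ² : α₀ > |α₁|}. Then: (1) f is strictly convex on C°; (2) the point α* := ½(√(ρ₀+ρ₁)+√(ρ₀−ρ₁), √(ρ₀+ρ₁)−√(ρ₀−ρ₁)) lies in C°, satisfies ∇f(α*) = 0, i.e. (α*₀² + α*₁² , 2α*₀α*₁) = (ρ₀, ρ₁), and is the unique global minimizer of f on C°. -/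
noncomputable section

/-- The open convex cone `C° = {α : α₀ > |α₁|}`. -/
def openCone : Set (ℝ × ℝ) := {α | |α.2| < α.1}

/-- In the coordinates `u = α₀ + α₁`, `v = α₀ - α₁` the cone is the open positive quadrant. -/
theorem mem_openCone_iff {α : ℝ × ℝ} : α ∈ openCone ↔ 0 < α.1 + α.2 ∧ 0 < α.1 - α.2 := by
  change |α.2| < α.1 ↔ _
  rw [abs_lt]
  constructor <;> rintro ⟨h₁, h₂⟩ <;> constructor <;> linarith

theorem convex_openCone : Convex ℝ openCone := by
  intro x hx y hy a b ha hb hab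
  rw [mem_openCone_iff] at *
  have key {p q : ℝ} (hp : 0 < p) (hq : 0 < q) : 0 < a * p + b * q :=
    convex_Ioi (0 : ℝ) hp hq ha hb hab
  have h₁ := key hx.1 hy.1
  have h₂ := key hx.2 hy.2
  simp only [Prod.fst_add, Prod.snd_add, Prod.smul_fst, Prod.smul_snd, smul_eq_mul]
  constructor <;> linarith

/-- A weighted sum of two squares with positive weights is positive off the diagonal, in the
coordinates `α₀ + α₁`, `α₀ - α₁`. -/
theorem sq_mul_add_sq_mul_pos_of_ne {x y : ℝ × ℝ} (hxy : x ≠ y) {c d : ℝ} (hc : 0 < c)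
    (hd : 0 < d) :
    0 < (x.1 + x.2 - (y.1 + y.2)) ^ 2 * c + (x.1 - x.2 - (y.1 - y.2)) ^ 2 * d := by
  by_cases h : x.1 + x.2 - (y.1 + y.2) = 0
  · have h' : x.1 - x.2 - (y.1 - y.2) ≠ 0 := fun h' ↦
      hxy (Prod.ext (by linarith) (by linarith))
    positivity
  · positivity

theorem strictConvexOn_cubic_objective (ρ : ℝ × ℝ) :
    StrictConvexOn ℝ openCone fun α : ℝ × ℝ ↦
      (1 / 3) * α.1 ^ 3 + α.1 * α.2 ^ 2 - α.1 * ρ.1 - α.2 * ρ.2 := by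
  refine ⟨convex_openCone, fun x hx y hy hxy a b ha hb hab ↦ ?_⟩
  rw [mem_openCone_iff] at hx hy
  obtain ⟨hx₁, hx₂⟩ := hx
  obtain ⟨hy₁, hy₂⟩ := hy
  have hc : 0 < (1 + a) * (x.1 + x.2) + (1 + b) * (y.1 + y.2) := by positivity
  have hd : 0 < (1 + a) * (x.1 - x.2) + (1 + b) * (y.1 - y.2) := by positivity
  have hpos := mul_pos (mul_pos ha hb) (sq_mul_add_sq_mul_pos_of_ne hxy hc hd)
  simp only [Prod.fst_add, Prod.snd_add, Prod.smul_fst, Prod.smul_snd, smul_eq_mul]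
  obtain rfl : b = 1 - a := by linarith
  linarith

/-- The gap of the objective above its value at a point `s` of the cone, when the linear term is
`ℛ(s) = (s₀² + s₁², 2s₀s₁)`. -/
theorem cubic_objective_lt_of_ne {s α : ℝ × ℝ} (hs : s ∈ openCone) (hα : α ∈ openCone)
    (hne : α ≠ s) :
    (1 / 3) * s.1 ^ 3 + s.1 * s.2 ^ 2 - s.1 * (s.1 ^ 2 + s.2 ^ 2) - s.2 * (2 * s.1 * s.2) <
      (1 / 3) * α.1 ^ 3 + α.1 * α.2 ^ 2 - α.1 * (s.1 ^ 2 + s.2 ^ 2) - α.2 * (2 * s.1 * s.2) := by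
  rw [mem_openCone_iff] at hs hα
  obtain ⟨hs₁, hs₂⟩ := hs
  obtain ⟨hα₁, hα₂⟩ := hα
  have hc : 0 < (α.1 + α.2) + 2 * (s.1 + s.2) := by positivity
  have hd : 0 < (α.1 - α.2) + 2 * (s.1 - s.2) := by positivity
  linarith [sq_mul_add_sq_mul_pos_of_ne hne hc hd]

theorem hasFDerivAt_cubic_objective (s : ℝ × ℝ) :
    HasFDerivAt (fun α : ℝ × ℝ ↦
      (1 / 3) * α.1 ^ 3 + α.1 * α.2 ^ 2 - α.1 * (s.1 ^ 2 + s.2 ^ 2) - α.2 * (2 * s.1 * s.2))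
      (0 : ℝ × ℝ →L[ℝ] ℝ) s := by
  have h₁ : HasFDerivAt (fun α : ℝ × ℝ ↦ α.1) (ContinuousLinearMap.fst ℝ ℝ ℝ) s := hasFDerivAt_fst
  have h₂ : HasFDerivAt (fun α : ℝ × ℝ ↦ α.2) (ContinuousLinearMap.snd ℝ ℝ ℝ) s := hasFDerivAt_snd
  refine (((((h₁.pow 3).const_mul (1 / 3)).add (h₁.mul (h₂.pow 2))).sub
    (h₁.mul_const (s.1 ^ 2 + s.2 ^ 2))).sub (h₂.mul_const (2 * s.1 * s.2))).congr_fderiv ?_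
  ext <;> simp
  ring

/-- Well-posedness of the optimization problem (2.3) defining the gPC modes of the
Euclidean norm (two basis functions): the objective
`f(α) = (1/3)α₀³ + α₀α₁² − α₀ρ₀ − α₁ρ₁` is strictly convex on `C°`, and the Galerkin
square root `α* = ℛ⁻¹(ρ)` is its unique global minimizer, a critical point satisfying
`ℛ(α*) = ρ`. -/
theorem optimization_problem_wellposed (ρ : ℝ × ℝ) (hρ : |ρ.2| < ρ.1) :
    let f : ℝ × ℝ → ℝ :=
      fun α => (1 / 3) * α.1 ^ 3 + α.1 * α.2 ^ 2 - α.1 * ρ.1 - α.2 * ρ.2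
    let αstar : ℝ × ℝ :=
      ((Real.sqrt (ρ.1 + ρ.2) + Real.sqrt (ρ.1 - ρ.2)) / 2,
       (Real.sqrt (ρ.1 + ρ.2) - Real.sqrt (ρ.1 - ρ.2)) / 2)
    StrictConvexOn ℝ openCone f ∧
    αstar ∈ openCone ∧
    HasFDerivAt f (0 : ℝ × ℝ →L[ℝ] ℝ) αstar ∧
    (αstar.1 ^ 2 + αstar.2 ^ 2, 2 * αstar.1 * αstar.2) = ρ ∧
    ∀ α ∈ openCone, α ≠ αstar → f αstar < f α := by
  intro f αstar
  obtain ⟨h₁, h₂⟩ := abs_lt.mp hρ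
  have hp : 0 < ρ.1 + ρ.2 := by linarith
  have hm : 0 < ρ.1 - ρ.2 := by linarith
  have hsp := Real.sqrt_pos.mpr hp
  have hsm := Real.sqrt_pos.mpr hm
  have hmem : αstar ∈ openCone := by
    rw [mem_openCone_iff]
    constructor <;> simp only [αstar] <;> linarith
  have hsq : (αstar.1 ^ 2 + αstar.2 ^ 2, 2 * αstar.1 * αstar.2) = ρ := by
    have hp' := Real.sq_sqrt hp.le
    have hm' := Real.sq_sqrt hm.le
    ext <;> simp only [αstar] <;> linarith
  have hf : f = fun α ↦ (1 / 3) * α.1 ^ 3 + α.1 * α.2 ^ 2 -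
      α.1 * (αstar.1 ^ 2 + αstar.2 ^ 2) - α.2 * (2 * αstar.1 * αstar.2) := by
    simp only [f, ← hsq]
  refine ⟨strictConvexOn_cubic_objective ρ, hmem, ?_, hsq, fun α hα hne ↦ ?_⟩
  · rw [hf]
    exact hasFDerivAt_cubic_objective αstar
  · rw [hf]
    exact cubic_objective_lt_of_ne hmem hα hne

end
end
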